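/- For all n ≥ 1, the inversion polynomials I_n(Π;q) = Σ_{σ∈Av_n(Π)} q^{inv σ} over permutations of {1,…,n} avoiding the pattern set Π = {132,213} satisfy the recurrence I_n({132,213};q) = Σ_{k=1}^{n} q^{k(n-k)} I_{n-k}({132,213};q), with I_0 = 1. -/

import Mathlib

open scoped Classical

/-- `σ` contains the pattern `π`. -/
def permContains {n k : ℕ} (σ : Equiv.Perm (Fin n)) (π : Equiv.Perm (Fin k)) : Prop :=
  ∃ f : Fin k → Fin n, StrictMono f ∧ ∀ i j : Fin k, π i < π j ↔ σ (f i) < σ (f j)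

/-- `σ` avoids the pattern `π`. -/
def permAvoids {n k : ℕ} (σ : Equiv.Perm (Fin n)) (π : Equiv.Perm (Fin k)) : Prop :=
  ¬ permContains σ π

def p123 : Equiv.Perm (Fin 3) := 1
def p132 : Equiv.Perm (Fin 3) := Equiv.swap 1 2
def p213 : Equiv.Perm (Fin 3) := Equiv.swap 0 1
def p231 : Equiv.Perm (Fin 3) := finRotate 3
def p312 : Equiv.Perm (Fin 3) := (finRotate 3)⁻¹
def p321 : Equiv.Perm (Fin 3) := Equiv.swap 0 2

/-- Descent set of a permutation, as a set of (1-based) positions `i` with `a_i > a_{i+1}`. -/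
def desSet {n : ℕ} (σ : Equiv.Perm (Fin n)) : Finset ℕ :=
  (Finset.Ico 1 n).filter
    (fun i => ∀ h : i < n, σ ⟨i, h⟩ < σ ⟨i - 1, Nat.lt_of_le_of_lt (Nat.sub_le i 1) h⟩)

/-- Major index: sum of descent positions. -/
def majIdx {n : ℕ} (σ : Equiv.Perm (Fin n)) : ℕ := ∑ i ∈ desSet σ, i

/-- Number of descents. -/
def desNum {n : ℕ} (σ : Equiv.Perm (Fin n)) : ℕ := (desSet σ).card

/-- Number of inversions. -/
def invNum {n : ℕ} (σ : Equiv.Perm (Fin n)) : ℕ :=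
  ((Finset.univ : Finset (Fin n × Fin n)).filter (fun p => p.1 < p.2 ∧ σ p.2 < σ p.1)).card

/-- The inversion polynomial of {132,213}-avoiding permutations, evaluated at q. -/
noncomputable def I132213 (n : ℕ) (q : ℚ) : ℚ :=
  ∑ σ ∈ Finset.univ.filter
      (fun σ : Equiv.Perm (Fin n) => permAvoids σ p132 ∧ permAvoids σ p213),
    q ^ invNum σ

theorem permAvoids_p132_iff {n : ℕ} (σ : Equiv.Perm (Fin n)) :
    permAvoids σ p132 ↔ ∀ a b c : Fin n, a < b → b < c → σ a < σ c → σ c < σ b → False := by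
  constructor
  · intro h a b c hab hbc h1 h2
    refine h ⟨![a, b, c], ?_, ?_⟩
    · rw [Fin.strictMono_iff_lt_succ]
      intro i
      fin_cases i <;> simpa
    · intro i j
      fin_cases i <;> fin_cases j <;> simp [p132, Equiv.swap_apply_def] <;> grind
  · rintro h ⟨f, hf, hp⟩
    exact h (f 0) (f 1) (f 2) (hf (by decide)) (hf (by decide))
      ((hp 0 2).1 (by decide)) ((hp 2 1).1 (by decide))

theorem permAvoids_p213_iff {n : ℕ} (σ : Equiv.Perm (Fin n)) :
    permAvoids σ p213 ↔ ∀ a b c : Fin n, a < b → b < c → σ b < σ a → σ a < σ c → False := by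
  constructor
  · intro h a b c hab hbc h1 h2
    refine h ⟨![a, b, c], ?_, ?_⟩
    · rw [Fin.strictMono_iff_lt_succ]
      intro i
      fin_cases i <;> simpa
    · intro i j
      fin_cases i <;> fin_cases j <;> simp [p213, Equiv.swap_apply_def] <;> grind
  · rintro h ⟨f, hf, hp⟩
    exact h (f 0) (f 1) (f 2) (hf (by decide)) (hf (by decide))
      ((hp 1 0).1 (by decide)) ((hp 0 2).1 (by decide))

/-- The skew sum of the identity of `Fin k` and `τ`: an increasing run of the `k` largest values,
followed by a copy of `τ` on the `m` smallest ones. -/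
def skewSumOne (k : ℕ) {m : ℕ} (τ : Equiv.Perm (Fin m)) : Equiv.Perm (Fin (k + m)) :=
  finSumFinEquiv.symm.trans ((Equiv.sumCongr (Equiv.refl (Fin k)) τ).trans
    ((Equiv.sumComm _ _).trans (finSumFinEquiv.trans (finCongr (Nat.add_comm m k)))))

@[simp]
theorem skewSumOne_castAdd (k : ℕ) {m : ℕ} (τ : Equiv.Perm (Fin m)) (i : Fin k) :
    (skewSumOne k τ (Fin.castAdd m i) : ℕ) = m + i := by
  simp [skewSumOne, add_comm]

@[simp]
theorem skewSumOne_natAdd (k : ℕ) {m : ℕ} (τ : Equiv.Perm (Fin m)) (j : Fin m) :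
    (skewSumOne k τ (Fin.natAdd k j) : ℕ) = τ j := by
  simp [skewSumOne]

theorem skewSumOne_injective (k m : ℕ) :
    Function.Injective (skewSumOne k : Equiv.Perm (Fin m) → Equiv.Perm (Fin (k + m))) := by
  intro τ₁ τ₂ h
  ext j
  rw [← skewSumOne_natAdd k τ₁ j, h, skewSumOne_natAdd]

theorem invNum_eq_sum {n : ℕ} (σ : Equiv.Perm (Fin n)) :
    invNum σ = ∑ i, ∑ j, if i < j ∧ σ j < σ i then 1 else 0 := by
  rw [invNum, Finset.card_filter, Fintype.sum_prod_type]

theorem invNum_skewSumOne (k : ℕ) {m : ℕ} (τ : Equiv.Perm (Fin m)) :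
    invNum (skewSumOne k τ) = k * m + invNum τ := by
  have early (i j : Fin k) : ¬ (i < j ∧ j < i) := by omega
  have cross (i : Fin k) (j : Fin m) : (i : ℕ) < k + j ∧ (τ j : ℕ) < m + i := by omega
  have back (i : Fin m) (j : Fin k) : ¬ (k + (i : ℕ) < j) := by omega
  simp only [invNum_eq_sum, Fin.sum_univ_add]
  simp only [Fin.lt_def, skewSumOne_castAdd, skewSumOne_natAdd, Fin.val_castAdd, Fin.val_natAdd,
    add_lt_add_iff_left]
  simp [cross, back, early]

theorem permAvoids_skewSumOne_iff (k : ℕ) {m : ℕ} (τ : Equiv.Perm (Fin m)) :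
    (permAvoids (skewSumOne k τ) p132 ∧ permAvoids (skewSumOne k τ) p213) ↔
      (permAvoids τ p132 ∧ permAvoids τ p213) := by
  simp only [permAvoids_p132_iff, permAvoids_p213_iff, Fin.forall_fin_add, Fin.lt_def,
    skewSumOne_castAdd, skewSumOne_natAdd, Fin.val_castAdd, Fin.val_natAdd, add_lt_add_iff_left]
  constructor
  · rintro ⟨h1, h2⟩
    exact ⟨fun a b c => (h1.2 a).2 b |>.2 c, fun a b c => (h2.2 a).2 b |>.2 c⟩
  · rintro ⟨h1, h2⟩
    refine ⟨⟨fun a => ⟨fun b => ⟨?_, ?_⟩, fun b => ⟨?_, ?_⟩⟩,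
        fun a => ⟨fun b => ⟨?_, ?_⟩, fun b => ⟨?_, h1 a b⟩⟩⟩,
      ⟨fun a => ⟨fun b => ⟨?_, ?_⟩, fun b => ⟨?_, ?_⟩⟩,
        fun a => ⟨fun b => ⟨?_, ?_⟩, fun b => ⟨?_, h2 a b⟩⟩⟩⟩ <;>
    intros <;> omega

theorem eq_skewSumOne_of_permAvoids {k m : ℕ} (hk : 1 ≤ k) (σ : Equiv.Perm (Fin (k + m)))
    (h132 : permAvoids σ p132) (h213 : permAvoids σ p213)
    (hmax : σ ⟨k - 1, by omega⟩ = ⟨k + m - 1, by omega⟩) :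
    ∃ τ : Equiv.Perm (Fin m), skewSumOne k τ = σ := by
  rw [permAvoids_p132_iff] at h132
  rw [permAvoids_p213_iff] at h213
  set p : Fin (k + m) := ⟨k - 1, by omega⟩ with hp
  have lt_max (i : Fin (k + m)) (hi : i ≠ p) : σ i < σ p := by
    have := σ.injective.ne hi
    rw [hmax] at this ⊢
    simp only [ne_eq, Fin.ext_iff, Fin.lt_def] at this ⊢
    omega
  have incr (i j : Fin (k + m)) (hij : i < j) (hj : (j : ℕ) < k) : σ i < σ j := by
    by_cases hjp : j = p
    · subst hjp
      exact lt_max i hij.ne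
    · have hjp' : j < p := by simp only [Fin.lt_def, Fin.ext_iff, hp] at *; omega
      by_contra hlt
      exact h213 i j p hij hjp' (lt_of_le_of_ne (not_lt.1 hlt) (σ.injective.ne hij.ne'))
        (lt_max i (hij.trans hjp').ne)
  have drop (i j : Fin (k + m)) (hi : (i : ℕ) < k) (hj : k ≤ (j : ℕ)) : σ j < σ i := by
    have hpj : p < j := by simp only [Fin.lt_def, hp]; omega
    by_cases hip : i = p
    · subst hip
      exact lt_max j hpj.ne'
    · have hip' : i < p := by simp only [Fin.lt_def, Fin.ext_iff, hp] at *; omega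
      by_contra hlt
      exact h132 i p j hip' hpj
        (lt_of_le_of_ne (not_lt.1 hlt) (σ.injective.ne (hip'.trans hpj).ne)) (lt_max j hpj.ne')
  have early (i : Fin k) : (σ (Fin.castAdd m i) : ℕ) = m + i := by
    have hcard : (σ (Fin.castAdd m i) : ℕ) =
        ∑ j, if σ j < σ (Fin.castAdd m i) then 1 else 0 := by
      rw [Equiv.sum_comp σ (fun v => if v < σ (Fin.castAdd m i) then 1 else 0),
        ← Finset.card_filter, Finset.filter_gt_eq_Iio, Fin.card_Iio]
    have hlt (j : Fin k) : σ (Fin.castAdd m j) < σ (Fin.castAdd m i) ↔ j < i := by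
      refine ⟨fun h => ?_, fun h => incr _ _ h (by simp)⟩
      by_contra hij
      rcases (not_lt.1 hij).eq_or_lt with rfl | hij
      · exact lt_irrefl _ h
      · exact lt_asymm h (incr _ _ hij (by simp))
    have hlate (j : Fin m) : σ (Fin.natAdd k j) < σ (Fin.castAdd m i) :=
      drop _ _ (by simp) (by simp)
    rw [hcard, Fin.sum_univ_add]
    simp only [hlt, hlate, if_true, ← Finset.card_filter, Finset.filter_gt_eq_Iio, Fin.card_Iio]
    simp [add_comm]
  have late (j : Fin m) : (σ (Fin.natAdd k j) : ℕ) < m := by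
    have := drop (Fin.castAdd m ⟨0, hk⟩) (Fin.natAdd k j) hk (by simp)
    rwa [Fin.lt_def, early, add_zero] at this
  have inj : Function.Injective (fun j : Fin m => (⟨σ (Fin.natAdd k j), late j⟩ : Fin m)) := by
    intro a b hab
    simpa [Fin.ext_iff, ← Fin.ext_iff (a := σ _)] using hab
  refine ⟨Equiv.ofBijective _ (Finite.injective_iff_bijective.1 inj), ?_⟩
  ext x
  induction x using Fin.addCases with
  | left i => rw [skewSumOne_castAdd, early]
  | right j => simp

theorem sum_permAvoids_max_at (q : ℚ) {k : ℕ} (hk : 1 ≤ k) (m : ℕ) :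
    ∑ σ : Equiv.Perm (Fin (k + m)) with
        (permAvoids σ p132 ∧ permAvoids σ p213) ∧
          σ ⟨k - 1, by omega⟩ = ⟨k + m - 1, by omega⟩, q ^ invNum σ =
      q ^ (k * m) * I132213 m q := by
  rw [I132213, Finset.mul_sum]
  symm
  refine Finset.sum_bij (fun τ _ => skewSumOne k τ) ?_ ?_ ?_ ?_
  · intro τ hτ
    simp only [Finset.mem_filter, Finset.mem_univ, true_and] at hτ ⊢
    refine ⟨(permAvoids_skewSumOne_iff k τ).2 hτ, Fin.ext ?_⟩
    have := skewSumOne_castAdd k τ ⟨k - 1, by omega⟩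
    simp only [Fin.castAdd_mk] at this
    simp only [this]
    omega
  · intro τ₁ _ τ₂ _ h
    exact skewSumOne_injective k m h
  · intro σ hσ
    simp only [Finset.mem_filter, Finset.mem_univ, true_and] at hσ
    obtain ⟨τ, rfl⟩ := eq_skewSumOne_of_permAvoids hk σ hσ.1.1 hσ.1.2 hσ.2
    exact ⟨τ, by simpa using (permAvoids_skewSumOne_iff k τ).1 hσ.1, rfl⟩
  · intro τ _
    rw [invNum_skewSumOne, pow_add]

theorem I132213_recurrence (q : ℚ) :
    I132213 0 q = 1 ∧
      ∀ n : ℕ, 1 ≤ n →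
        I132213 n q = ∑ k ∈ Finset.Icc 1 n, q ^ (k * (n - k)) * I132213 (n - k) q := by
  constructor
  · have h (σ : Equiv.Perm (Fin 0)) :
        (permAvoids σ p132 ∧ permAvoids σ p213) ∧ invNum σ = 0 := by
      refine ⟨⟨?_, ?_⟩, by simp [invNum]⟩ <;> exact fun ⟨f, _⟩ => (f 0).elim0
    simp [I132213, h]
  · intro n hn
    rw [I132213, ← Finset.sum_fiberwise_of_maps_to (t := Finset.Icc 1 n)
      (g := fun σ : Equiv.Perm (Fin n) => (σ.symm ⟨n - 1, by omega⟩ : ℕ) + 1)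
      (fun σ _ => by simp only [Finset.mem_Icc]; omega)]
    refine Finset.sum_congr rfl fun k hk => ?_
    obtain ⟨hk_pos, hkn⟩ := Finset.mem_Icc.1 hk
    obtain ⟨m, rfl⟩ := Nat.exists_eq_add_of_le hkn
    rw [Nat.add_sub_cancel_left, ← sum_permAvoids_max_at q hk_pos m, Finset.filter_filter]
    refine Finset.sum_congr (Finset.filter_congr fun σ _ => and_congr_right fun _ => ?_)
      fun _ _ => rfl
    rw [← Equiv.eq_symm_apply, Fin.ext_iff]
    simp only
    omega
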